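/- arXiv:1902.07628 — 2 statements merged into one kernel-verified Lean document; each statement's English description precedes it below -/
import Mathlib

section
/- The supplementary code B_{u,m} is completely regular with intersection array {q^m - q^u, q^u - 1; 1, q^m - q^u}. -/
/-- The distance from a vector `x` to a code `C`. -/
noncomputable def distToCode {F : Type} [Fintype F] [DecidableEq F] {n : ℕ}
    (C : Set (Fin n → F)) (x : Fin n → F) : ℕ :=
  sInf (Set.image (hammingDist x) C)

/-- The supplementary code `B_{u,m}`: the code whose parity-check matrix consists of
the `inr`-columns of `H`. -/
def suppCode {F : Type} [Field F] {m nu nB : ℕ}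
    (H : Matrix (Fin m) (Fin nu ⊕ Fin nB) F) : Submodule F (Fin nB → F) :=
  LinearMap.ker (Matrix.mulVecLin (Matrix.of fun i j => H i (Sum.inr j)))

theorem hammingDist_eq_one_iff_exists_single {F : Type} [Field F] [DecidableEq F] {n : ℕ}
    {x y : Fin n → F} :
    hammingDist x y = 1 ↔ ∃ j, ∃ a : F, a ≠ 0 ∧ y = x + Pi.single j a := by
  constructor
  · intro h
    obtain ⟨j, hj⟩ := Finset.card_eq_one.mp h
    have hmem : ∀ i, x i ≠ y i ↔ i = j := fun i => by
      simpa using Finset.ext_iff.mp hj i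
    refine ⟨j, y j - x j, sub_ne_zero.mpr ((hmem j).mpr rfl).symm, ?_⟩
    funext i
    by_cases hi : i = j
    · subst hi
      simp
    · have := not_not.mp (mt (hmem i).mp hi)
      simp [hi, this]
  · rintro ⟨j, a, ha, rfl⟩
    refine Finset.card_eq_one.mpr ⟨j, ?_⟩
    ext i
    by_cases hi : i = j
    · subst hi
      simp [ha]
    · simp [hi]

theorem distToCode_le_of_mem {F : Type} [Fintype F] [DecidableEq F] {n : ℕ}
    {C : Set (Fin n → F)} {x c : Fin n → F} (hc : c ∈ C) :
    distToCode C x ≤ hammingDist x c :=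
  Nat.sInf_le ⟨c, hc, rfl⟩

theorem exists_hammingDist_eq_distToCode {F : Type} [Fintype F] [DecidableEq F] {n : ℕ}
    {C : Set (Fin n → F)} (hC : C.Nonempty) (x : Fin n → F) :
    ∃ c ∈ C, hammingDist x c = distToCode C x :=
  Nat.sInf_mem (hC.image _)

section Syndrome

variable {F : Type} [Field F] [DecidableEq F] {n : ℕ}
  {V : Type} [AddCommGroup V] [Module F V] {S : Submodule F V} {s : (Fin n → F) →ₗ[F] V}

/-- A syndrome map under which the vectors of weight one correspond bijectively to the complement
of the subspace `S`. -/
structure IsSuppSyndrome (S : Submodule F V) (s : (Fin n → F) →ₗ[F] V) : Prop where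
  bijOn : Set.BijOn s {e | hammingDist 0 e = 1} {w | w ∉ S}

namespace IsSuppSyndrome

theorem bijOn_neighbors (hs : IsSuppSyndrome S s) (x : Fin n → F) :
    Set.BijOn s {y | hammingDist x y = 1} {t | t - s x ∉ S} := by
  have hd : ∀ y, hammingDist x y = hammingDist 0 (y - x) := fun y => by
    rw [hammingDist_eq_hammingNorm, hammingDist_zero_left, neg_add_eq_sub]
  refine ⟨fun y hy => ?_, fun y hy z hz hyz => ?_, fun t ht => ?_⟩
  · have := hs.bijOn.mapsTo (x := y - x) (by simpa [hd] using hy)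
    simpa using this
  · have := hs.bijOn.injOn (x₁ := y - x) (x₂ := z - x) (by simpa [hd] using hy)
      (by simpa [hd] using hz) (by simp [hyz])
    simpa using this
  · obtain ⟨e, he, het⟩ := hs.bijOn.surjOn (a := t - s x) ht
    refine ⟨x + e, ?_, by simp [het]⟩
    simpa [hd] using he

theorem exists_neighbor (hs : IsSuppSyndrome S s) (x : Fin n → F) {t : V} (ht : t - s x ∉ S) :
    ∃ y, hammingDist x y = 1 ∧ s y = t :=
  (hs.bijOn_neighbors x).surjOn ht

theorem surjective (hs : IsSuppSyndrome S s) (hS : ∃ w, w ∉ S) : Function.Surjective s := by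
  intro t
  by_cases ht : t ∈ S
  · obtain ⟨w, hw⟩ := hS
    obtain ⟨y, -, hsy⟩ := hs.exists_neighbor 0 (t := w) (by simpa using hw)
    obtain ⟨z, -, hsz⟩ := hs.exists_neighbor y (t := t)
      (fun h => hw (by simpa [hsy] using S.sub_mem ht h))
    exact ⟨z, hsz⟩
  · obtain ⟨y, -, hsy⟩ := hs.exists_neighbor 0 (t := t) (by simpa using ht)
    exact ⟨y, hsy⟩

theorem card_neighbors (hs : IsSuppSyndrome S s) (x : Fin n → F) {P : (Fin n → F) → Prop}
    {T : Set V} (hPT : ∀ y, P y ↔ s y ∈ T) :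
    Nat.card {y : Fin n → F | hammingDist x y = 1 ∧ P y} =
      ({t | t - s x ∉ S} ∩ T).ncard := by
  have hb := hs.bijOn_neighbors x
  refine (Set.BijOn.ncard_eq (f := s) ?_ :)
  refine ⟨fun y hy => ⟨hb.mapsTo hy.1, (hPT y).mp hy.2⟩,
    hb.injOn.mono fun y hy => hy.1, fun t ht => ?_⟩
  obtain ⟨y, hy, rfl⟩ := hb.surjOn ht.1
  exact ⟨y, ⟨hy, (hPT y).mpr ht.2⟩, rfl⟩

variable [Fintype F]

theorem _root_.distToCode_ker_eq_zero_iff (x : Fin n → F) :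
    distToCode (LinearMap.ker s : Set (Fin n → F)) x = 0 ↔ s x = 0 := by
  constructor
  · intro h
    obtain ⟨c, hc, hxc⟩ := exists_hammingDist_eq_distToCode
      (C := (LinearMap.ker s : Set (Fin n → F))) ⟨0, by simp⟩ x
    rw [h, hammingDist_eq_zero] at hxc
    subst hxc
    simpa using hc
  · intro h
    have := distToCode_le_of_mem (C := (LinearMap.ker s : Set (Fin n → F))) (x := x) (c := x)
      (by simpa using h)
    simpa using this

theorem distToCode_eq_one_iff (hs : IsSuppSyndrome S s) (x : Fin n → F) :
    distToCode (LinearMap.ker s : Set (Fin n → F)) x = 1 ↔ s x ∉ S := by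
  constructor
  · intro h
    obtain ⟨c, hc, hxc⟩ := exists_hammingDist_eq_distToCode
      (C := (LinearMap.ker s : Set (Fin n → F))) ⟨0, by simp⟩ x
    rw [h] at hxc
    have := (hs.bijOn_neighbors x).mapsTo hxc
    have hc' : s c = 0 := by simpa using hc
    simpa [hc'] using this
  · intro h
    obtain ⟨y, hy, hsy⟩ := hs.exists_neighbor x (t := 0) (by simpa using h)
    have h1 := distToCode_le_of_mem (C := (LinearMap.ker s : Set (Fin n → F))) (x := x) (c := y)
      (by simpa using hsy)
    have h0 : distToCode (LinearMap.ker s : Set (Fin n → F)) x ≠ 0 := fun h0 =>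
      h (by rw [(distToCode_ker_eq_zero_iff x).mp h0]; exact S.zero_mem)
    omega

theorem distToCode_le_two (hs : IsSuppSyndrome S s) (hS : ∃ w, w ∉ S) (x : Fin n → F) :
    distToCode (LinearMap.ker s : Set (Fin n → F)) x ≤ 2 := by
  by_cases hx : s x ∈ S
  · obtain ⟨w, hw⟩ := hS
    obtain ⟨y, hy, hsy⟩ := hs.exists_neighbor x (t := w)
      (fun h => hw (by simpa using S.add_mem h hx))
    obtain ⟨z, hz, hsz⟩ := hs.exists_neighbor y (t := 0) (by simpa [hsy] using hw)
    have h1 := distToCode_le_of_mem (C := (LinearMap.ker s : Set (Fin n → F))) (x := x) (c := z)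
      (by simpa using hsz)
    have := hammingDist_triangle x y z
    omega
  · have := (hs.distToCode_eq_one_iff x).mpr hx
    omega

theorem distToCode_eq_two_iff (hs : IsSuppSyndrome S s) (hS : ∃ w, w ∉ S) (x : Fin n → F) :
    distToCode (LinearMap.ker s : Set (Fin n → F)) x = 2 ↔ s x ∈ S ∧ s x ≠ 0 := by
  have h0 := distToCode_ker_eq_zero_iff (s := s) x
  have h1 := hs.distToCode_eq_one_iff x
  have h2 := hs.distToCode_le_two hS x
  constructor
  · intro h
    exact ⟨by_contra fun hx => by have := h1.mpr hx; omega, fun hx => by have := h0.mpr hx; omega⟩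
  · rintro ⟨hx, hx0⟩
    have := mt h0.mp hx0
    have := mt h1.mp (not_not.mpr hx)
    omega

theorem completely_regular [Finite V] (hs : IsSuppSyndrome S s) (hS : ∃ w, w ∉ S)
    (hS' : ∃ w ∈ S, w ≠ 0) {B : Set (Fin n → F)} (hB : B = (LinearMap.ker s : Set (Fin n → F))) :
    (∀ x, distToCode B x ≤ 2) ∧ (∃ x, distToCode B x = 2) ∧
    (∀ x, distToCode B x = 0 →
      Nat.card {y : Fin n → F | hammingDist x y = 1 ∧ distToCode B y = 1}
        = Nat.card V - Nat.card S) ∧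
    (∀ x, distToCode B x = 1 →
      Nat.card {y : Fin n → F | hammingDist x y = 1 ∧ distToCode B y = 2}
          = Nat.card S - 1 ∧
      Nat.card {y : Fin n → F | hammingDist x y = 1 ∧ distToCode B y = 0} = 1) ∧
    (∀ x, distToCode B x = 2 →
      Nat.card {y : Fin n → F | hammingDist x y = 1 ∧ distToCode B y = 1}
        = Nat.card V - Nat.card S) := by
  subst hB
  have hcompl : ((S : Set V)ᶜ).ncard = Nat.card V - Nat.card S := Set.ncard_compl _
  have hinner : ∀ x, s x ∈ S →
      Nat.card {y : Fin n → F | hammingDist x y = 1 ∧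
        distToCode (LinearMap.ker s : Set (Fin n → F)) y = 1} = Nat.card V - Nat.card S := by
    intro x hx
    rw [hs.card_neighbors x (T := (S : Set V)ᶜ) (fun y => hs.distToCode_eq_one_iff y), ← hcompl]
    congr 1
    ext t
    simp [S.sub_mem_iff_left hx]
  refine ⟨hs.distToCode_le_two hS, ?_, fun x hx => ?_, fun x hx => ⟨?_, ?_⟩, fun x hx => ?_⟩
  · obtain ⟨w, hw, hw0⟩ := hS'
    obtain ⟨x, rfl⟩ := hs.surjective hS w
    exact ⟨x, (hs.distToCode_eq_two_iff hS x).mpr ⟨hw, hw0⟩⟩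
  · exact hinner x (by rw [(distToCode_ker_eq_zero_iff x).mp hx]; exact S.zero_mem)
  · rw [hs.distToCode_eq_one_iff] at hx
    rw [hs.card_neighbors x (T := (S : Set V) \ {0})
      (fun y => by simpa using hs.distToCode_eq_two_iff hS y)]
    have : {t | t - s x ∉ S} ∩ ((S : Set V) \ {0}) = (S : Set V) \ {0} := by
      refine Set.inter_eq_right.mpr fun t ht h => hx ?_
      simpa using S.sub_mem ht.1 h
    rw [this, Set.ncard_sdiff_singleton_of_mem S.zero_mem]
    rfl
  · rw [hs.distToCode_eq_one_iff] at hx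
    rw [hs.card_neighbors x (T := {0}) (fun y => by simpa using distToCode_ker_eq_zero_iff y)]
    rw [Set.ncard_eq_one]
    refine ⟨0, Set.inter_eq_right.mpr ?_⟩
    simpa using hx
  · exact hinner x ((hs.distToCode_eq_two_iff hS x).mp hx).1

end IsSuppSyndrome

end Syndrome

/-- The subspace of the vectors that vanish on the coordinates from `u` on. -/
def initialCoordSubspace (F : Type) [Field F] (m u : ℕ) : Submodule F (Fin m → F) where
  carrier := {v | ∀ i : Fin m, u ≤ (i : ℕ) → v i = 0}
  zero_mem' := fun _ _ => rfl
  add_mem' := fun hv hw i hi => by simp [hv i hi, hw i hi]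
  smul_mem' := fun a v hv i hi => by simp [hv i hi]

theorem mem_initialCoordSubspace {F : Type} [Field F] {m u : ℕ} {v : Fin m → F} :
    v ∈ initialCoordSubspace F m u ↔ ∀ i : Fin m, u ≤ (i : ℕ) → v i = 0 := Iff.rfl

theorem card_initialCoordSubspace {F : Type} [Field F] [Fintype F] {m u : ℕ} (hum : u ≤ m) :
    Nat.card (initialCoordSubspace F m u) = Fintype.card F ^ u := by
  let f : initialCoordSubspace F m u → Fin u → F := fun v i => v.1 (Fin.castLE hum i)
  have hf : Function.Bijective f := by
    constructor
    · rintro ⟨v, hv⟩ ⟨w, hw⟩ h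
      ext i
      by_cases hi : (i : ℕ) < u
      · exact congrFun h ⟨i, hi⟩
      · exact (hv i (not_lt.mp hi)).trans (hw i (not_lt.mp hi)).symm
    · intro g
      refine ⟨⟨fun i => if h : (i : ℕ) < u then g ⟨i, h⟩ else 0, fun i hi => ?_⟩, ?_⟩
      · simp [not_lt.mpr hi]
      · funext i
        simp [f]
  rw [Nat.card_eq_of_bijective f hf]
  simp

theorem isSuppSyndrome_of_columns {F : Type} [Field F] [Fintype F] [DecidableEq F]
    {m u nu nB : ℕ} (hum : u ≤ m)
    (hnu : nu * (Fintype.card F - 1) = Fintype.card F ^ u - 1)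
    (H : Matrix (Fin m) (Fin nu ⊕ Fin nB) F)
    (hcols : ∀ j, (fun i => H i j) ≠ 0)
    (hindep : ∀ j k, j ≠ k → ∀ a : F, (fun i => a * H i j) ≠ (fun i => H i k))
    (hmax : ∀ v : Fin m → F, v ≠ 0 → ∃ j, ∃ a : F, v = fun i => a * H i j)
    (hvan : ∀ j : Fin nu, ∀ i : Fin m, u ≤ (i : ℕ) → H i (Sum.inl j) = 0) :
    IsSuppSyndrome (initialCoordSubspace F m u)
      (Matrix.mulVecLin (Matrix.of fun i j => H i (Sum.inr j)) :
        (Fin nB → F) →ₗ[F] (Fin m → F)) := by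
  set S := initialCoordSubspace F m u with hS
  set s : (Fin nB → F) →ₗ[F] (Fin m → F) :=
    Matrix.mulVecLin (Matrix.of fun i j => H i (Sum.inr j)) with hs
  have hsingle : ∀ j a, s (Pi.single j a) = a • H.col (Sum.inr j) := by
    intro j a
    funext i
    simp [hs, mul_comm]
  have hinj : ∀ j k (a b : F), b ≠ 0 → a • H.col j = b • H.col k → j = k ∧ a = b := by
    intro j k a b hb h
    have hjk : j = k := by
      by_contra hjk
      refine hindep j k hjk (b⁻¹ * a) ?_
      have := congrArg (b⁻¹ • ·) h
      simp only [smul_smul, inv_mul_cancel₀ hb, one_smul] at this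
      exact this
    subst hjk
    exact ⟨rfl, smul_left_injective F (hcols j) h⟩
  let φ : Fin nu × Fˣ → (Fin m → F) := fun p => (p.2 : F) • H.col (Sum.inl p.1)
  have hφ : Function.Injective φ := by
    rintro ⟨j, a⟩ ⟨k, b⟩ h
    obtain ⟨h1, h2⟩ := hinj _ _ _ _ b.ne_zero h
    exact Prod.ext (Sum.inl_injective h1) (Units.ext h2)
  have hrange : Set.range φ = (S : Set (Fin m → F)) \ {0} := by
    refine Set.eq_of_subset_of_ncard_le ?_ ?_
    · rintro _ ⟨⟨j, a⟩, rfl⟩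
      refine ⟨S.smul_mem _ (hvan j), ?_⟩
      exact smul_ne_zero a.ne_zero (hcols _)
    · rw [Set.ncard_range_of_injective hφ, Set.ncard_sdiff_singleton_of_mem S.zero_mem]
      have : (S : Set (Fin m → F)).ncard = Fintype.card F ^ u := card_initialCoordSubspace hum
      rw [this, ← hnu]
      simp [Fintype.card_units]
  refine ⟨⟨?_, ?_, ?_⟩⟩
  · rintro _ he hmem
    obtain ⟨j, a, ha, rfl⟩ := hammingDist_eq_one_iff_exists_single.mp he
    rw [zero_add, hsingle] at hmem
    have : a • H.col (Sum.inr j) ∈ Set.range φ := by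
      rw [hrange]
      exact ⟨hmem, smul_ne_zero ha (hcols _)⟩
    obtain ⟨⟨k, b⟩, h⟩ := this
    exact Sum.inl_ne_inr (hinj _ _ _ _ ha h).1
  · rintro _ he _ he' h
    obtain ⟨j, a, ha, rfl⟩ := hammingDist_eq_one_iff_exists_single.mp he
    obtain ⟨k, b, hb, rfl⟩ := hammingDist_eq_one_iff_exists_single.mp he'
    rw [zero_add, zero_add, hsingle, hsingle] at h
    obtain ⟨h1, h2⟩ := hinj _ _ _ _ hb h
    rw [Sum.inr_injective h1, h2]
  · intro w hw
    have hw0 : w ≠ 0 := fun h => hw (h ▸ S.zero_mem)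
    obtain ⟨j, a, rfl⟩ := hmax w hw0
    have ha : a ≠ 0 := by
      rintro rfl
      exact hw0 (by funext i; simp)
    rcases j with j | j
    · exact absurd (S.smul_mem a (hvan j)) hw
    · refine ⟨Pi.single j a, hammingDist_eq_one_iff_exists_single.mpr ⟨j, a, ha, by simp⟩, ?_⟩
      exact hsingle j a

/-- `B_{u,m}` is completely regular with covering radius 2 and
intersection array `{q^m - q^u, q^u - 1; 1, q^m - q^u}`. -/
theorem supplementary_code_completely_regular
    {F : Type} [Field F] [Fintype F] [DecidableEq F]
    (q m u nu nB : ℕ) (hq : Fintype.card F = q) (hm : 1 < m)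
    (hu1 : 1 ≤ u) (hum : u ≤ m - 1)
    (hnu : nu * (q - 1) = q ^ u - 1)
    (hn : (nu + nB) * (q - 1) = q ^ m - 1)
    (H : Matrix (Fin m) (Fin nu ⊕ Fin nB) F)
    (hcols : ∀ j, (fun i => H i j) ≠ 0)
    (hindep : ∀ j k, j ≠ k → ∀ a : F, (fun i => a * H i j) ≠ (fun i => H i k))
    (hmax : ∀ v : Fin m → F, v ≠ 0 → ∃ j, ∃ a : F, v = fun i => a * H i j)
    (hvan : ∀ j : Fin nu, ∀ i : Fin m, u ≤ (i : ℕ) → H i (Sum.inl j) = 0)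
    (B : Set (Fin nB → F))
    (hB : B = ((suppCode H : Submodule F (Fin nB → F)) : Set (Fin nB → F))) :
    -- covering radius 2
    (∀ x, distToCode B x ≤ 2) ∧ (∃ x, distToCode B x = 2) ∧
    -- b_0 = q^m - q^u
    (∀ x, distToCode B x = 0 →
      Nat.card {y : Fin nB → F | hammingDist x y = 1 ∧ distToCode B y = 1}
        = q ^ m - q ^ u) ∧
    -- b_1 = q^u - 1 and c_1 = 1
    (∀ x, distToCode B x = 1 →
      Nat.card {y : Fin nB → F | hammingDist x y = 1 ∧ distToCode B y = 2}
          = q ^ u - 1 ∧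
      Nat.card {y : Fin nB → F | hammingDist x y = 1 ∧ distToCode B y = 0} = 1) ∧
    -- c_2 = q^m - q^u
    (∀ x, distToCode B x = 2 →
      Nat.card {y : Fin nB → F | hammingDist x y = 1 ∧ distToCode B y = 1}
        = q ^ m - q ^ u) := by
  subst hq
  have hcard : Nat.card (initialCoordSubspace F m u) = Fintype.card F ^ u :=
    card_initialCoordSubspace (by omega)
  have hV : Nat.card (Fin m → F) = Fintype.card F ^ m := by simp
  have hS : ∃ w, w ∉ initialCoordSubspace F m u :=
    ⟨fun _ => 1, fun h => one_ne_zero (h ⟨u, by omega⟩ le_rfl)⟩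
  have hS' : ∃ w ∈ initialCoordSubspace F m u, w ≠ 0 := by
    refine ⟨Pi.single ⟨0, by omega⟩ 1, fun i hi => ?_, by simp⟩
    refine Pi.single_eq_of_ne (fun h => ?_) _
    subst h
    simp at hi
    omega
  rw [← hV, ← hcard]
  exact (isSuppSyndrome_of_columns (by omega) hnu H hcols hindep hmax hvan).completely_regular
    hS hS' hB
end

section
/- The number of cosets of B_{u,m} in F_q^{n_B} whose minimum weight equals 2 is exactly q^u - 1. -/
/-- The minimum weight of a coset of a linear code. -/
noncomputable def cosetMinWeight {F : Type} [Field F] [Fintype F] [DecidableEq F]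
    {n : ℕ} (C : Submodule F (Fin n → F)) (D : (Fin n → F) ⧸ C) : ℕ :=
  sInf {w : ℕ | ∃ x : Fin n → F, Submodule.Quotient.mk x = D ∧ hammingNorm x = w}

/-- The vectors of `F ^ m` vanishing on all coordinates of index at least `u`. -/
def initialVectors (F : Type) [Field F] (m u : ℕ) : Set (Fin m → F) :=
  {v | ∀ i : Fin m, u ≤ (i : ℕ) → v i = 0}

theorem ncard_initialVectors {F : Type} [Field F] [Fintype F] {m u : ℕ} (h : u ≤ m) :
    (initialVectors F m u).ncard = Fintype.card F ^ u := by
  let e : (Fin u → F) → (Fin m → F) := fun v i => if hi : (i : ℕ) < u then v ⟨i, hi⟩ else 0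
  have he : Function.Injective e := by
    intro v w hvw
    funext i
    simpa [e] using congrFun hvw (Fin.castLE h i)
  have hr : initialVectors F m u = Set.range e := by
    ext v
    constructor
    · intro hv
      refine ⟨fun i => v (Fin.castLE h i), ?_⟩
      funext i
      by_cases hi : (i : ℕ) < u
      · simp [e, hi]
      · simp [e, hi, hv i (not_lt.mp hi)]
    · rintro ⟨w, rfl⟩ i hi
      simp [e, not_lt.mpr hi]
  rw [hr, ← Nat.card_coe_set_eq, Nat.card_range_of_injective he]
  simp [Nat.card_eq_fintype_card]

theorem zero_mem_initialVectors {F : Type} [Field F] {m u : ℕ} :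
    (0 : Fin m → F) ∈ initialVectors F m u := fun _ _ => rfl

theorem ncard_initialVectors_diff_zero {F : Type} [Field F] [Fintype F] {m u : ℕ} (h : u ≤ m) :
    (initialVectors F m u \ {0}).ncard = Fintype.card F ^ u - 1 := by
  rw [Set.ncard_sdiff_singleton_of_mem zero_mem_initialVectors, ncard_initialVectors h]

/-- Pairwise non-proportional vectors of `initialVectors F m u`, as many as there are points in
the corresponding projective space, represent every point. -/
theorem exists_eq_smul_of_mem_initialVectors {F : Type} [Field F] [Fintype F] {m u n : ℕ}
    (hu : u ≤ m) (hn : n * (Fintype.card F - 1) = Fintype.card F ^ u - 1)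
    (c : Fin n → Fin m → F) (hc : ∀ j, c j ∈ initialVectors F m u) (hc0 : ∀ j, c j ≠ 0)
    (hindep : ∀ j k, j ≠ k → ∀ a : F, a • c j ≠ c k)
    {v : Fin m → F} (hv : v ∈ initialVectors F m u) (hv0 : v ≠ 0) :
    ∃ j, ∃ a : F, v = a • c j := by
  classical
  let f : Fin n × Fˣ → Fin m → F := fun p => (p.2 : F) • c p.1
  have hf : Function.Injective f := by
    rintro ⟨j, a⟩ ⟨k, b⟩ h
    have h' : (a : F) • c j = (b : F) • c k := h
    obtain rfl : j = k := by
      by_contra hjk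
      refine hindep j k hjk ((b : F)⁻¹ * a) ?_
      rw [mul_smul, h', smul_smul, inv_mul_cancel₀ b.ne_zero, one_smul]
    have := smul_left_injective F (hc0 j) h'
    simp [Units.ext_iff, this]
  have hsub : Set.range f ⊆ initialVectors F m u \ {0} := by
    rintro _ ⟨⟨j, a⟩, rfl⟩
    refine ⟨fun i hi => ?_, smul_ne_zero a.ne_zero (hc0 j)⟩
    simp [f, hc j i hi]
  have hcard : (Set.range f).ncard = Fintype.card F ^ u - 1 := by
    rw [← Nat.card_coe_set_eq, Nat.card_range_of_injective hf, Nat.card_eq_fintype_card,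
      Fintype.card_prod, Fintype.card_fin, Fintype.card_units, hn]
  have heq := Set.eq_of_subset_of_ncard_le hsub
    (by rw [hcard, ncard_initialVectors_diff_zero hu]) (Set.toFinite _)
  obtain ⟨⟨j, a⟩, rfl⟩ : v ∈ Set.range f := heq ▸ ⟨hv, hv0⟩
  exact ⟨j, a, rfl⟩

theorem cosetMinWeight_eq_two_iff {F : Type} [Field F] [Fintype F] [DecidableEq F] {n : ℕ}
    (C : Submodule F (Fin n → F)) (D : (Fin n → F) ⧸ C) :
    cosetMinWeight C D = 2 ↔
      (∃ x : Fin n → F, Submodule.Quotient.mk x = D ∧ hammingNorm x ≤ 2) ∧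
        ∀ x : Fin n → F, Submodule.Quotient.mk x = D → 2 ≤ hammingNorm x := by
  constructor
  · intro h
    have hne : {w : ℕ | ∃ x : Fin n → F, Submodule.Quotient.mk x = D ∧ hammingNorm x = w}.Nonempty :=
      (Submodule.Quotient.mk_surjective C D).imp' hammingNorm fun x hx => ⟨x, hx, rfl⟩
    obtain ⟨x, hx, hxw⟩ := Nat.sInf_mem hne
    refine ⟨⟨x, hx, (hxw.trans h).le⟩, fun y hy => ?_⟩
    rw [← h]
    exact Nat.sInf_le ⟨y, hy, rfl⟩
  · rintro ⟨⟨x, hx, hx2⟩, hmin⟩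
    refine le_antisymm (le_trans (Nat.sInf_le ⟨x, hx, rfl⟩) hx2) ?_
    refine le_csInf ⟨_, x, hx, rfl⟩ ?_
    rintro _ ⟨y, hy, rfl⟩
    exact hmin y hy

theorem hammingNorm_single_le_one {F ι : Type} [Field F] [DecidableEq F] [Fintype ι]
    [DecidableEq ι] (j : ι) (a : F) : hammingNorm (Pi.single j a : ι → F) ≤ 1 := by
  refine (Finset.card_le_card (t := {j}) fun i hi => ?_).trans (Finset.card_singleton j).le
  by_contra hij
  simp_all [Pi.single_apply]

theorem exists_eq_single_of_hammingNorm_le_one {F ι : Type} [Field F] [DecidableEq F]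
    [Fintype ι] [DecidableEq ι] {x : ι → F} (hx0 : x ≠ 0) (hx : hammingNorm x ≤ 1) :
    ∃ j, ∃ a : F, x = Pi.single j a := by
  obtain ⟨j, hj⟩ := Function.ne_iff.mp hx0
  refine ⟨j, x j, funext fun i => ?_⟩
  by_cases hij : i = j
  · subst hij; simp
  · rw [Pi.single_eq_of_ne hij]
    by_contra hi
    exact hij (Finset.card_le_one.mp hx i (by simpa using hi) j (by simpa using hj))

/-- the number of cosets of `B_{u,m}` of minimum weight 2 is `q^u - 1`. -/
theorem supplementary_code_weight_two_cosets
    {F : Type} [Field F] [Fintype F] [DecidableEq F]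
    (q m u nu nB : ℕ) (hq : Fintype.card F = q) (hm : 1 < m)
    (hu1 : 1 ≤ u) (hum : u ≤ m - 1)
    (hnu : nu * (q - 1) = q ^ u - 1)
    (hn : (nu + nB) * (q - 1) = q ^ m - 1)
    (H : Matrix (Fin m) (Fin nu ⊕ Fin nB) F)
    (hcols : ∀ j, (fun i => H i j) ≠ 0)
    (hindep : ∀ j k, j ≠ k → ∀ a : F, (fun i => a * H i j) ≠ (fun i => H i k))
    (hmax : ∀ v : Fin m → F, v ≠ 0 → ∃ j, ∃ a : F, v = fun i => a * H i j)
    (hvan : ∀ j : Fin nu, ∀ i : Fin m, u ≤ (i : ℕ) → H i (Sum.inl j) = 0) :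
    Nat.card {D : (Fin nB → F) ⧸ suppCode H | cosetMinWeight (suppCode H) D = 2}
      = q ^ u - 1 := by
  subst hq
  have hum' : u < m := by omega
  have hcol {j : Fin nu} {v : Fin m → F} {a : F} (h : v = fun i => a * H i (Sum.inl j)) :
      v ∈ initialVectors F m u := by
    subst h
    intro i hi
    simp [hvan j i hi]
  have hinl {v : Fin m → F} (hv : v ∈ initialVectors F m u) (hv0 : v ≠ 0) :
      ∃ j, ∃ a : F, v = fun i => a * H i (Sum.inl j) :=
    exists_eq_smul_of_mem_initialVectors hum'.le hnu (fun j i => H i (Sum.inl j))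
      (fun j i hi => hvan j i hi) (fun j => hcols _)
      (fun j k hjk a => hindep _ _ (fun h => hjk (Sum.inl_injective h)) a) hv hv0
  let M : (Fin nB → F) →ₗ[F] (Fin m → F) :=
    Matrix.mulVecLin (Matrix.of fun i j => H i (Sum.inr j))
  have hsingle (j : Fin nB) (a : F) : M (Pi.single j a) = fun i => a * H i (Sum.inr j) := by
    funext i
    simp [M, Matrix.mulVec_single, mul_comm]
  have hinr {v : Fin m → F} (hv : v ∉ initialVectors F m u) :
      ∃ j, ∃ a : F, M (Pi.single j a) = v := by
    obtain ⟨j | j, a, h⟩ := hmax v fun h => hv (h ▸ zero_mem_initialVectors)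
    · exact absurd (hcol h) hv
    · exact ⟨j, a, (hsingle j a).trans h.symm⟩
  let φ : ((Fin nB → F) ⧸ suppCode H) →ₗ[F] (Fin m → F) := (suppCode H).liftQ M le_rfl
  have hφ : Function.Injective φ :=
    LinearMap.ker_eq_bot.mp (Submodule.ker_liftQ_eq_bot _ _ _ le_rfl)
  have hmk (x : Fin nB → F) (D : (Fin nB → F) ⧸ suppCode H) :
      Submodule.Quotient.mk x = D ↔ M x = φ D := hφ.eq_iff.symm
  have himage : φ '' {D | cosetMinWeight (suppCode H) D = 2} = initialVectors F m u \ {0} := by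
    ext v
    constructor
    · rintro ⟨D, hD, rfl⟩
      obtain ⟨-, hmin⟩ := (cosetMinWeight_eq_two_iff _ _).mp hD
      refine ⟨?_, fun h0 => ?_⟩
      · by_contra hv
        obtain ⟨j, a, h⟩ := hinr hv
        have := hmin _ ((hmk _ _).mpr h)
        have := hammingNorm_single_le_one j a
        omega
      · have := hmin 0 ((hmk _ _).mpr ((map_zero M).trans (Set.mem_singleton_iff.mp h0).symm))
        simp at this
    · rintro ⟨hv, hv0⟩
      rw [Set.mem_singleton_iff] at hv0
      let w : Fin m → F := Pi.single ⟨u, hum'⟩ 1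
      have hw : w ∉ initialVectors F m u := fun h => by
        simpa [w] using h ⟨u, hum'⟩ le_rfl
      have hvw : v - w ∉ initialVectors F m u := fun h => by
        simpa [w, hv ⟨u, hum'⟩ le_rfl] using h ⟨u, hum'⟩ le_rfl
      obtain ⟨j, a, hj⟩ := hinr hw
      obtain ⟨k, b, hk⟩ := hinr hvw
      obtain ⟨x, hx, hx2⟩ : ∃ x, M x = v ∧ hammingNorm x ≤ 2 := by
        refine ⟨Pi.single j a + Pi.single k b, by rw [map_add, hj, hk, add_sub_cancel], ?_⟩
        have h := hammingDist_triangle (Pi.single j a + Pi.single k b : Fin nB → F)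
          (Pi.single j a) 0
        rw [hammingDist_zero_right, hammingDist_zero_right, hammingDist_comm,
          hammingDist_eq_hammingNorm, neg_add_cancel_left] at h
        have := hammingNorm_single_le_one j a
        have := hammingNorm_single_le_one k b
        omega
      refine ⟨Submodule.Quotient.mk x, ?_, hx⟩
      refine (cosetMinWeight_eq_two_iff _ _).mpr ⟨⟨x, rfl, hx2⟩, fun y hy => ?_⟩
      · have hMy : M y = v := ((hmk _ _).mp hy).trans hx
        by_contra hlt
        have hy0 : y ≠ 0 := by
          rintro rfl
          exact hv0 (hMy.symm.trans (map_zero M))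
        obtain ⟨l, c, rfl⟩ := exists_eq_single_of_hammingNorm_le_one hy0 (by omega)
        obtain ⟨i, d, hd⟩ := hinl hv hv0
        have hc : c ≠ 0 := by
          rintro rfl
          exact hy0 (Pi.single_zero l)
        have hcd : (fun i => c * H i (Sum.inr l)) = fun r => d * H r (Sum.inl i) :=
          (hsingle l c).symm.trans (hMy.trans hd)
        refine hindep (Sum.inl i) (Sum.inr l) (by simp) (c⁻¹ * d) (funext fun r => ?_)
        rw [mul_assoc, ← congrFun hcd r, inv_mul_cancel_left₀ hc]
  rw [Nat.card_coe_set_eq, ← Set.ncard_image_of_injective _ hφ, himage,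
    ncard_initialVectors_diff_zero hum'.le]
end
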